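/- There is a unique Q(q^{1/2})-linear involutive anti-automorphism alpha-bar of the Kashiwara algebra K_q satisfying alpha-bar(gamma^{+-1/2}) = gamma^{+-1/2}, alpha-bar(x^-_{i,m}) = Omega_{psi_i}(-m), and alpha-bar(Omega_{psi_i}(m)) = x^-_{i,-m} for all 1 <= i <= N and all m in Z. -/

import Mathlib

/-!
STATEMENT 12: the unique involutive anti-automorphism `ᾱ` of the Kashiwara
algebra `K_q`.
-/


noncomputable section
open scoped BigOperators

abbrev Fq : Type := RatFunc ℚ
def sqq : Fq := RatFunc.X
def qq : Fq := sqq ^ 2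

variable {N : ℕ}
variable (d : Fin N → ℤ) (A : Fin N → Fin N → ℤ)

def qp (i j : Fin N) : Fq := qq ^ (d i * A i j)

/-- Generators of the Kashiwara algebra `K_q`. -/
inductive KGen (N : ℕ) : Type
  | Om (j : Fin N) (m : ℤ)
  | xm (i : Fin N) (n : ℤ)
  | g2
  | g2inv

abbrev KFA (N : ℕ) : Type := FreeAlgebra Fq (KGen N)

def ke (x : KGen N) : KFA N := FreeAlgebra.ι Fq x

/-- `γ = (γ^{1/2})^2` in the free algebra on the Kashiwara generators. -/
def kgamma : KFA N := ke KGen.g2 * ke KGen.g2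

/-- The defining relations of the Kashiwara algebra `K_q`. -/
inductive KRel (N : ℕ) (d : Fin N → ℤ) (A : Fin N → Fin N → ℤ) : KFA N → KFA N → Prop
  | g_ginv : KRel N d A (ke KGen.g2 * ke KGen.g2inv) 1
  | ginv_g : KRel N d A (ke KGen.g2inv * ke KGen.g2) 1
  | g2_comm (x : KGen N) : KRel N d A (ke KGen.g2 * ke x) (ke x * ke KGen.g2)
  | g2inv_comm (x : KGen N) : KRel N d A (ke KGen.g2inv * ke x) (ke x * ke KGen.g2inv)
  | K1 (i j : Fin N) (m n : ℤ) :
      KRel N d A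
        (qp d A i j • (kgamma * ke (KGen.Om j m) * ke (KGen.xm i (n+1))) -
          ke (KGen.Om j (m+1)) * ke (KGen.xm i n))
        ((if i = j ∧ m = -n - 1 then qp d A i j • kgamma - 1 else 0) +
          kgamma * ke (KGen.xm i (n+1)) * ke (KGen.Om j m) -
          qp d A i j • (ke (KGen.xm i n) * ke (KGen.Om j (m+1))))
  | K2 (i j : Fin N) (k l : ℤ) :
      KRel N d A
        (qp d A i j • (ke (KGen.Om i (k+1)) * ke (KGen.Om j l)) -
          ke (KGen.Om j l) * ke (KGen.Om i (k+1)))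
        (ke (KGen.Om i k) * ke (KGen.Om j (l+1)) -
          qp d A i j • (ke (KGen.Om j (l+1)) * ke (KGen.Om i k)))
  | K3 (i j : Fin N) (k l : ℤ) :
      KRel N d A
        (ke (KGen.xm i (k+1)) * ke (KGen.xm j l) -
          (qp d A i j)⁻¹ • (ke (KGen.xm j l) * ke (KGen.xm i (k+1))))
        ((qp d A i j)⁻¹ • (ke (KGen.xm i k) * ke (KGen.xm j (l+1))) -
          ke (KGen.xm j (l+1)) * ke (KGen.xm i k))

/-- The Kashiwara algebra `K_q`. -/
abbrev Kq (N : ℕ) (d : Fin N → ℤ) (A : Fin N → Fin N → ℤ) : Type := RingQuot (KRel N d A)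

/-- The image of a generator in `K_q`. -/
def KG (x : KGen N) : Kq N d A := RingQuot.mkAlgHom Fq (KRel N d A) (ke x)



namespace Kq

open MulOpposite

variable {d A}

theorem qp_symm (hsym : ∀ i j, d i * A i j = d j * A j i) (i j : Fin N) :
    qp d A j i = qp d A i j := by
  unfold qp
  rw [hsym]

theorem qp_ne_zero (i j : Fin N) : qp d A i j ≠ 0 :=
  zpow_ne_zero _ (pow_ne_zero _ RatFunc.X_ne_zero)

theorem mkAlgHom_ke (x : KGen N) : RingQuot.mkAlgHom Fq (KRel N d A) (ke x) = KG d A x := rfl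

theorem g2_mul_g2inv : KG d A KGen.g2 * KG d A KGen.g2inv = 1 := by
  simpa only [map_mul, map_one, mkAlgHom_ke] using
    RingQuot.mkAlgHom_rel Fq (KRel.g_ginv (d := d) (A := A))

theorem g2inv_mul_g2 : KG d A KGen.g2inv * KG d A KGen.g2 = 1 := by
  simpa only [map_mul, map_one, mkAlgHom_ke] using
    RingQuot.mkAlgHom_rel Fq (KRel.ginv_g (d := d) (A := A))

theorem g2_commute (x : KGen N) : Commute (KG d A KGen.g2) (KG d A x) := by
  simpa only [commute_iff_eq, map_mul, mkAlgHom_ke] using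
    RingQuot.mkAlgHom_rel Fq (KRel.g2_comm (d := d) (A := A) x)

theorem g2inv_commute (x : KGen N) : Commute (KG d A KGen.g2inv) (KG d A x) := by
  simpa only [commute_iff_eq, map_mul, mkAlgHom_ke] using
    RingQuot.mkAlgHom_rel Fq (KRel.g2inv_comm (d := d) (A := A) x)

variable (d A) in
/-- The image of `γ` in `K_q`. -/
def gamma : Kq N d A := KG d A KGen.g2 * KG d A KGen.g2

theorem mkAlgHom_kgamma : RingQuot.mkAlgHom Fq (KRel N d A) kgamma = gamma d A :=
  map_mul _ _ _

theorem gamma_commute (x : KGen N) : Commute (gamma d A) (KG d A x) :=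
  (g2_commute x).mul_left (g2_commute x)

theorem gamma_mul_mul (x y : KGen N) :
    gamma d A * KG d A x * KG d A y = KG d A x * (KG d A y * gamma d A) := by
  rw [(gamma_commute x).eq, mul_assoc, (gamma_commute y).eq]

theorem Om_xm_relation (i j : Fin N) (m n : ℤ) :
    qp d A i j • (gamma d A * KG d A (KGen.Om j m) * KG d A (KGen.xm i (n + 1))) -
        KG d A (KGen.Om j (m + 1)) * KG d A (KGen.xm i n) =
      (if i = j ∧ m = -n - 1 then qp d A i j • gamma d A - 1 else 0) +
        gamma d A * KG d A (KGen.xm i (n + 1)) * KG d A (KGen.Om j m) -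
        qp d A i j • (KG d A (KGen.xm i n) * KG d A (KGen.Om j (m + 1))) := by
  simpa only [map_mul, map_one, map_zero, map_sub, map_add, map_smul, apply_ite, mkAlgHom_ke,
    mkAlgHom_kgamma] using RingQuot.mkAlgHom_rel Fq (KRel.K1 (d := d) (A := A) i j m n)

theorem Om_Om_relation (i j : Fin N) (k l : ℤ) :
    qp d A i j • (KG d A (KGen.Om i (k + 1)) * KG d A (KGen.Om j l)) -
        KG d A (KGen.Om j l) * KG d A (KGen.Om i (k + 1)) =
      KG d A (KGen.Om i k) * KG d A (KGen.Om j (l + 1)) -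
        qp d A i j • (KG d A (KGen.Om j (l + 1)) * KG d A (KGen.Om i k)) := by
  simpa only [map_mul, map_sub, map_smul, mkAlgHom_ke] using
    RingQuot.mkAlgHom_rel Fq (KRel.K2 (d := d) (A := A) i j k l)

theorem xm_xm_relation (i j : Fin N) (k l : ℤ) :
    KG d A (KGen.xm i (k + 1)) * KG d A (KGen.xm j l) -
        (qp d A i j)⁻¹ • (KG d A (KGen.xm j l) * KG d A (KGen.xm i (k + 1))) =
      (qp d A i j)⁻¹ • (KG d A (KGen.xm i k) * KG d A (KGen.xm j (l + 1))) -
        KG d A (KGen.xm j (l + 1)) * KG d A (KGen.xm i k) := by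
  simpa only [map_mul, map_sub, map_smul, mkAlgHom_ke] using
    RingQuot.mkAlgHom_rel Fq (KRel.K3 (d := d) (A := A) i j k l)

theorem algHom_ext {B : Type*} [Semiring B] [Algebra Fq B] {f g : Kq N d A →ₐ[Fq] B}
    (h : ∀ x, f (KG d A x) = g (KG d A x)) : f = g := by
  apply RingQuot.ringQuot_ext'
  apply FreeAlgebra.hom_ext
  funext x
  exact h x

/-- The involution of the generators underlying `ᾱ`. -/
def swapGen : KGen N → KGen N
  | KGen.Om j m => KGen.xm j (-m)
  | KGen.xm i n => KGen.Om i (-n)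
  | KGen.g2 => KGen.g2
  | KGen.g2inv => KGen.g2inv

theorem swapGen_g2 : swapGen (KGen.g2 : KGen N) = KGen.g2 := rfl

theorem swapGen_g2inv : swapGen (KGen.g2inv : KGen N) = KGen.g2inv := rfl

theorem swapGen_swapGen (x : KGen N) : swapGen (swapGen x) = x := by
  cases x <;> simp [swapGen]

variable (d A) in
/-- The lift of `ᾱ` to the free algebra. -/
def freeAntiHom : KFA N →ₐ[Fq] (Kq N d A)ᵐᵒᵖ :=
  FreeAlgebra.lift Fq fun x => op (KG d A (swapGen x))

theorem freeAntiHom_ke (x : KGen N) : freeAntiHom d A (ke x) = op (KG d A (swapGen x)) :=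
  FreeAlgebra.lift_ι_apply _ _

theorem freeAntiHom_kgamma : freeAntiHom d A kgamma = op (gamma d A) := by
  simp only [kgamma, map_mul, freeAntiHom_ke, swapGen_g2, gamma, op_mul]

theorem freeAntiHom_rel (hsym : ∀ i j, d i * A i j = d j * A j i) ⦃a b : KFA N⦄
    (h : KRel N d A a b) : freeAntiHom d A a = freeAntiHom d A b := by
  apply unop_injective
  induction h with
  | g_ginv => simp [freeAntiHom_ke, swapGen, g2inv_mul_g2]
  | ginv_g => simp [freeAntiHom_ke, swapGen, g2_mul_g2inv]
  | g2_comm x => simpa [freeAntiHom_ke, swapGen_g2] using (g2_commute (swapGen x)).eq.symm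
  | g2inv_comm x => simpa [freeAntiHom_ke, swapGen_g2inv] using (g2inv_commute (swapGen x)).eq.symm
  | K1 i j m n =>
    have h := Om_xm_relation (d := d) (A := A) j i (-(n + 1)) (-(m + 1))
    rw [qp_symm hsym i j, show -(m + 1) + 1 = -m by ring, show -(n + 1) + 1 = -n by ring,
      gamma_mul_mul, gamma_mul_mul] at h
    have hij : (j = i ∧ -(n + 1) = - -(m + 1) - 1) ↔ (i = j ∧ m = -n - 1) := by
      constructor <;> rintro ⟨rfl, h⟩ <;> exact ⟨rfl, by lia⟩
    simpa only [hij, map_mul, map_one, map_zero, map_add, map_sub, map_smul, apply_ite,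
      freeAntiHom_ke, freeAntiHom_kgamma, swapGen, unop_sub, unop_add, unop_smul, unop_mul,
      unop_one, unop_zero, unop_op] using h
  | K2 i j k l =>
    have h := congrArg (qp d A i j • ·)
      (xm_xm_relation (d := d) (A := A) j i (-(l + 1)) (-(k + 1)))
    rw [qp_symm hsym i j, show -(l + 1) + 1 = -l by ring, show -(k + 1) + 1 = -k by ring] at h
    simpa only [smul_sub, smul_inv_smul₀ (qp_ne_zero i j), map_mul, map_sub, map_smul,
      freeAntiHom_ke, swapGen, unop_sub, unop_smul, unop_mul, unop_op] using h
  | K3 i j k l =>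
    have h := congrArg ((qp d A i j)⁻¹ • ·)
      (Om_Om_relation (d := d) (A := A) j i (-(l + 1)) (-(k + 1)))
    rw [qp_symm hsym i j, show -(l + 1) + 1 = -l by ring, show -(k + 1) + 1 = -k by ring] at h
    simpa only [smul_sub, inv_smul_smul₀ (qp_ne_zero i j), map_mul, map_sub, map_smul,
      freeAntiHom_ke, swapGen, unop_sub, unop_smul, unop_mul, unop_op] using h

/-- The anti-automorphism `ᾱ`, as a homomorphism to the opposite algebra. -/
def antiHom (hsym : ∀ i j, d i * A i j = d j * A j i) : Kq N d A →ₐ[Fq] (Kq N d A)ᵐᵒᵖ :=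
  RingQuot.liftAlgHom Fq ⟨freeAntiHom d A, freeAntiHom_rel hsym⟩

theorem antiHom_KG (hsym : ∀ i j, d i * A i j = d j * A j i) (x : KGen N) :
    antiHom hsym (KG d A x) = op (KG d A (swapGen x)) :=
  (RingQuot.liftAlgHom_mkAlgHom_apply _ _ _ _).trans (freeAntiHom_ke x)

theorem antiHom_involutive (hsym : ∀ i j, d i * A i j = d j * A j i) :
    Function.Involutive fun x => (antiHom hsym x).unop := by
  have h : (AlgHom.opComm (antiHom hsym)).comp (antiHom hsym) = AlgHom.id Fq (Kq N d A) :=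
    algHom_ext fun x => by simp [AlgHom.opComm, antiHom_KG, swapGen_swapGen]
  exact fun x => DFunLike.congr_fun h x

end Kq

open MulOpposite in
/-- There is a unique `ℚ(q^{1/2})`-linear involutive anti-automorphism
`ᾱ` of the Kashiwara algebra `K_q` with `ᾱ(γ^{±1/2}) = γ^{±1/2}`,
`ᾱ(x^-_{i,m}) = Ω_{ψ_i}(-m)` and `ᾱ(Ω_{ψ_i}(m)) = x^-_{i,-m}`.  (An anti-automorphism is
realized as a bijective algebra homomorphism `K_q →ₐ K_qᵐᵒᵖ`.) -/
theorem kashiwara_antiautomorphism_exists_unique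
    (hN : 0 < N)
    (hdpos : ∀ i, 0 < d i)
    (hgcd : Finset.univ.gcd (fun i => (d i).natAbs) = 1)
    (hdiag : ∀ i, A i i = 2)
    (hoff : ∀ i j, i ≠ j → A i j ≤ 0)
    (hsym : ∀ i j, d i * A i j = d j * A j i) :
    ∃! f : Kq N d A →ₐ[Fq] (Kq N d A)ᵐᵒᵖ,
      Function.Bijective f ∧
      (∀ x : Kq N d A, (f ((f x).unop)).unop = x) ∧
      f (KG d A KGen.g2) = op (KG d A KGen.g2) ∧
      f (KG d A KGen.g2inv) = op (KG d A KGen.g2inv) ∧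
      (∀ (i : Fin N) (m : ℤ), f (KG d A (KGen.xm i m)) = op (KG d A (KGen.Om i (-m)))) ∧
      (∀ (i : Fin N) (m : ℤ), f (KG d A (KGen.Om i m)) = op (KG d A (KGen.xm i (-m)))) := by
  refine ⟨Kq.antiHom hsym, ⟨?_, Kq.antiHom_involutive hsym, Kq.antiHom_KG hsym _,
    Kq.antiHom_KG hsym _, fun i m => Kq.antiHom_KG hsym _, fun i m => Kq.antiHom_KG hsym _⟩, ?_⟩
  · exact opEquiv.symm.bijective.of_comp_iff' _ |>.mp (Kq.antiHom_involutive hsym).bijective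
  · rintro g ⟨-, -, hg, hginv, hxm, hOm⟩
    refine Kq.algHom_ext fun x => ?_
    rw [Kq.antiHom_KG]
    cases x with
    | Om j m => exact hOm j m
    | xm i n => exact hxm i n
    | g2 => exact hg
    | g2inv => exact hginv

end
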